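/- Let λ, μ ∈ ℝ with μ > 0 and λ + μ > 0, set α := (λ+μ)/(λ+3μ) and c := −(λ+μ)/(λ+3μ), let R > 0 and let k ≥ 1 be an integer. Define ψ̂_k : ℝ² → ℝ² by ψ̂_k(x) = (r^k cos(kθ), −r^k sin(kθ)) for r ≤ R and ψ̂_k(x) = R^{2k}( r^{−k} cos(kθ) + kα(r²−R²) r^{−k−2} cos((k+2)θ), −r^{−k} sin(kθ) + kα(r²−R²) r^{−k−2} sin((k+2)θ) ) for r > R, and define A : ℝ² → ℝ by A(x) = c for ‖x‖ ≤ R and A(x) = 1 for ‖x‖ > R. Then for every continuously differentiable, compactly supported φ : ℝ² → ℝ², one has ∫_{ℝ²} A(x) [ λ (∇·ψ̂_k)(∇·φ) + 2μ ∇^s ψ̂_k : ∇^s φ ] dx = 0, where ∇^s u = (∇u + (∇u)ᵀ)/2 and ':' is the Frobenius inner product of matrices (i.e., ψ̂_k is a weak solution of ∇·(A C_{λ,μ} ∇^s ψ) = 0 on ℝ²). -/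

import Mathlib

open Real MeasureTheory

noncomputable section

/-- Partial derivative in the first coordinate direction. -/
def pdx (f : ℝ × ℝ → ℝ) (x : ℝ × ℝ) : ℝ := fderiv ℝ f x (1, 0)

/-- Partial derivative in the second coordinate direction. -/
def pdy (f : ℝ × ℝ → ℝ) (x : ℝ × ℝ) : ℝ := fderiv ℝ f x (0, 1)

/-- Divergence of a planar vector field. -/
def div2 (u : ℝ × ℝ → ℝ × ℝ) (x : ℝ × ℝ) : ℝ :=
  pdx (fun y => (u y).1) x + pdy (fun y => (u y).2) x

/-- Componentwise Laplacian. -/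
def lap2 (f : ℝ × ℝ → ℝ) (x : ℝ × ℝ) : ℝ :=
  pdx (fun y => pdx f y) x + pdy (fun y => pdy f y) x

/-- The Lamé operator  μ Δu + (λ+μ) ∇(∇·u). -/
def lame2 (lam mu : ℝ) (u : ℝ × ℝ → ℝ × ℝ) (x : ℝ × ℝ) : ℝ × ℝ :=
  (mu * lap2 (fun y => (u y).1) x + (lam + mu) * pdx (fun y => div2 u y) x,
   mu * lap2 (fun y => (u y).2) x + (lam + mu) * pdy (fun y => div2 u y) x)

/-- Conormal derivative  λ(∇·u)ν + μ(∇u + (∇u)ᵀ)ν. -/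
def trac (lam mu : ℝ) (u : ℝ × ℝ → ℝ × ℝ) (x ν : ℝ × ℝ) : ℝ × ℝ :=
  (lam * div2 u x * ν.1
      + mu * (2 * pdx (fun y => (u y).1) x * ν.1
        + (pdy (fun y => (u y).1) x + pdx (fun y => (u y).2) x) * ν.2),
   lam * div2 u x * ν.2
      + mu * ((pdy (fun y => (u y).1) x + pdx (fun y => (u y).2) x) * ν.1
        + 2 * pdy (fun y => (u y).2) x * ν.2))

/-- Entries of the symmetric gradient ∇ˢu = (∇u + (∇u)ᵀ)/2. -/
def sg11 (u : ℝ × ℝ → ℝ × ℝ) (x : ℝ × ℝ) : ℝ := pdx (fun y => (u y).1) x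

def sg12 (u : ℝ × ℝ → ℝ × ℝ) (x : ℝ × ℝ) : ℝ :=
  (pdy (fun y => (u y).1) x + pdx (fun y => (u y).2) x) / 2

def sg22 (u : ℝ × ℝ → ℝ × ℝ) (x : ℝ × ℝ) : ℝ := pdy (fun y => (u y).2) x

/-- Frobenius inner product ∇ˢu : ∇ˢv of the symmetric gradients of two fields. -/
def sgFrob (u v : ℝ × ℝ → ℝ × ℝ) (x : ℝ × ℝ) : ℝ :=
  sg11 u x * sg11 v x + 2 * (sg12 u x * sg12 v x) + sg22 u x * sg22 v x

/-- Euclidean norm on ℝ². -/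
def nr (x : ℝ × ℝ) : ℝ := Real.sqrt (x.1 ^ 2 + x.2 ^ 2)

section LipschitzJacobian

open Filter Topology Metric Set
open scoped NNReal

variable {E : Type*} [NormedAddCommGroup E] [NormedSpace ℝ E]

lemma support_fderiv_apply_subset {g : E → ℝ} (v : E) :
    Function.support (fun x => fderiv ℝ g x v) ⊆ tsupport g := fun x hx =>
  support_fderiv_subset ℝ (fun h => hx (by simp [h]))

variable [FiniteDimensional ℝ E]

/-- A locally Lipschitz function agrees, near the support of a test function, with a Lipschitz
function. -/
lemma LocallyLipschitz.exists_lipschitzWith_lineDeriv_eq {f g : E → ℝ} (hf : LocallyLipschitz f)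
    (hgc : HasCompactSupport g) :
    ∃ (C : ℝ≥0) (F : E → ℝ), LipschitzWith C F ∧
      ∀ x ∈ tsupport g, ∀ v, lineDeriv ℝ f x v = lineDeriv ℝ F x v := by
  let K := cthickening 1 (tsupport g)
  have hK : IsCompact K := IsCompact.cthickening hgc
  obtain ⟨C, hC⟩ := (hf.locallyLipschitzOn (s := K)).exists_lipschitzOnWith_of_compact hK
  obtain ⟨F, hF, hEq⟩ := hC.extend_real
  refine ⟨C, F, hF, fun x hx v => Filter.EventuallyEq.lineDeriv_eq ?_⟩
  have : K ∈ 𝓝 x := mem_of_superset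
    (isOpen_thickening.mem_nhds (self_subset_thickening one_pos _ hx))
    (thickening_subset_cthickening 1 _)
  filter_upwards [this] with y hy using hEq hy

variable [MeasurableSpace E] [BorelSpace E] {ν : Measure E} [ν.IsAddHaarMeasure]

/-- Line derivatives of a Lipschitz function commute in the distributional sense. -/
theorem LipschitzWith.integral_lineDeriv_mul_fderiv_comm {f g : E → ℝ} {C : ℝ≥0}
    (hf : LipschitzWith C f) (hg : ContDiff ℝ 1 g) (hgc : HasCompactSupport g) (v w : E) :
    ∫ x, lineDeriv ℝ f x v * fderiv ℝ g x w ∂ν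
      = ∫ x, lineDeriv ℝ f x w * fderiv ℝ g x v ∂ν := by
  obtain ⟨D, hD⟩ := hg.lipschitzWith_of_hasCompactSupport hgc one_ne_zero
  have hgd : Differentiable ℝ g := hg.differentiable one_ne_zero
  have hcont (u : E) : Continuous fun x => fderiv ℝ g x u :=
    (hg.continuous_fderiv one_ne_zero).clm_apply continuous_const
  have hint (u : E) : Integrable (fun x => fderiv ℝ g x u) ν :=
    (hcont u).integrable_of_hasCompactSupport
      (hgc.mono' (support_fderiv_apply_subset u))
  let K := cthickening ‖w‖ (tsupport g)
  have hK : IsCompact K := IsCompact.cthickening hgc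
  have hsub : tsupport g ⊆ K := self_subset_cthickening _
  let h : E → ℝ := K.indicator fun x => lineDeriv ℝ f x v
  have hh : Integrable h ν :=
    (integrable_indicator_iff hK.measurableSet).2
      (((hf.locallyIntegrable_lineDeriv v).integrableOn_isCompact hK))
  have hlim := hD.integral_inv_smul_sub_mul_tendsto_integral_lineDeriv_mul hh (-w)
  have hlim' := hf.integral_inv_smul_sub_mul_tendsto_integral_lineDeriv_mul (hint (-v)) w
  have key : ∀ t ∈ Ioc (0 : ℝ) 1, ∫ x, (t⁻¹ • (g (x + t • -w) - g x)) * h x ∂ν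
      = ∫ x, (t⁻¹ • (f (x + t • w) - f x)) * fderiv ℝ g x (-v) ∂ν := by
    intro t ht
    let q : E → ℝ := fun x => t⁻¹ • (g (x + t • -w) - g x)
    have hqK : Function.support q ⊆ K := by
      intro x hx
      by_contra hxK
      apply hx
      have h0 : g x = 0 := by
        by_contra h0
        exact hxK (hsub (subset_tsupport _ h0))
      have h1 : g (x + t • -w) = 0 := by
        by_contra h1
        refine hxK (mem_cthickening_of_dist_le _ _ _ _ (subset_tsupport _ h1) ?_)
        simpa [dist_eq_norm, norm_smul, abs_of_pos ht.1] using
          mul_le_of_le_one_left (norm_nonneg w) ht.2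
      simp only [q, h0, h1, sub_self, smul_zero]
    have hqc : HasCompactSupport q := HasCompactSupport.of_support_subset_isCompact hK hqK
    have hqs : ContDiff ℝ 1 q := by
      simp only [q]
      fun_prop
    obtain ⟨D', hD'⟩ := hqs.lipschitzWith_of_hasCompactSupport hqc one_ne_zero
    have hql (x : E) : lineDeriv ℝ q x (-v)
        = t⁻¹ * (fderiv ℝ g (x + t • -w) (-v) - fderiv ℝ g x (-v)) := by
      rw [(hqs.differentiable one_ne_zero x).lineDeriv_eq_fderiv]
      have h1 : HasFDerivAt (fun y => g (y + t • -w)) (fderiv ℝ g (x + t • -w)) x :=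
        (hasFDerivAt_comp_add_right _).2 (hgd _).hasFDerivAt
      have h2 : HasFDerivAt q _ x := (h1.sub (hgd x).hasFDerivAt).const_smul t⁻¹
      rw [h2.fderiv]
      simp
    have hfi : Integrable (fun x => f x * fderiv ℝ g x (-v)) ν :=
      (hf.continuous.mul (hcont _)).integrable_of_hasCompactSupport
        (hgc.mono' ((Function.support_mul_subset_right _ _).trans
          (support_fderiv_apply_subset _)))
    have hfi' : Integrable (fun x => f (x + t • w) * fderiv ℝ g x (-v)) ν :=
      ((hf.continuous.comp (by fun_prop)).mul (hcont _)).integrable_of_hasCompactSupport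
        (hgc.mono' ((Function.support_mul_subset_right _ _).trans
          (support_fderiv_apply_subset _)))
    have hshift : (fun x => f (x + t • w) * fderiv ℝ g x (-v))
        = fun x => (fun y => f y * fderiv ℝ g (y + t • -w) (-v)) (x + t • w) := by
      ext x
      simp
    have hfi'' : Integrable (fun y => f y * fderiv ℝ g (y + t • -w) (-v)) ν := by
      have := hfi'.comp_add_right (t • -w)
      simpa using this
    calc ∫ x, q x * h x ∂ν = ∫ x, lineDeriv ℝ f x v * q x ∂ν := by
          congr with x
          by_cases hx : x ∈ K
          · simp [h, hx, mul_comm]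
          · have : q x = 0 := by
              by_contra h0
              exact hx (hqK h0)
            simp [this]
      _ = ∫ x, lineDeriv ℝ q x (-v) * f x ∂ν := hf.integral_lineDeriv_mul_eq hD' hqc v
      _ = t⁻¹ * ((∫ x, f x * fderiv ℝ g (x + t • -w) (-v) ∂ν)
            - ∫ x, f x * fderiv ℝ g x (-v) ∂ν) := by
          rw [← integral_sub hfi'' hfi, ← integral_const_mul]
          congr with x
          rw [hql]
          ring
      _ = t⁻¹ * ((∫ x, f (x + t • w) * fderiv ℝ g x (-v) ∂ν)
            - ∫ x, f x * fderiv ℝ g x (-v) ∂ν) := by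
          rw [hshift, integral_add_right_eq_self (μ := ν)
            (fun y => f y * fderiv ℝ g (y + t • -w) (-v))]
      _ = ∫ x, (t⁻¹ • (f (x + t • w) - f x)) * fderiv ℝ g x (-v) ∂ν := by
          rw [← integral_sub hfi' hfi, ← integral_const_mul]
          congr with x
          rw [smul_eq_mul]
          ring
  have hev : ∀ᶠ t : ℝ in 𝓝[>] 0, ∫ x, (t⁻¹ • (g (x + t • -w) - g x)) * h x ∂ν
      = ∫ x, (t⁻¹ • (f (x + t • w) - f x)) * fderiv ℝ g x (-v) ∂ν := by
    filter_upwards [Ioc_mem_nhdsGT zero_lt_one] with t ht using key t ht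
  have heq := tendsto_nhds_unique (hlim.congr' hev) hlim'
  have hl : ∫ x, lineDeriv ℝ g x (-w) * h x ∂ν
      = -∫ x, lineDeriv ℝ f x v * fderiv ℝ g x w ∂ν := by
    rw [← integral_neg]
    congr with x
    rw [(hgd x).lineDeriv_eq_fderiv]
    by_cases hx : x ∈ K
    · simp [h, hx, mul_comm]
    · have : fderiv ℝ g x w = 0 := by
        by_contra h0
        exact hx (hsub (support_fderiv_apply_subset w h0))
      simp [this]
  have hr : ∫ x, lineDeriv ℝ f x w * fderiv ℝ g x (-v) ∂ν
      = -∫ x, lineDeriv ℝ f x w * fderiv ℝ g x v ∂ν := by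
    rw [← integral_neg]
    congr with x
    simp
  linarith

lemma LocallyLipschitz.integrable_lineDeriv_mul_fderiv {f g : E → ℝ} (hf : LocallyLipschitz f)
    (hg : ContDiff ℝ 1 g) (hgc : HasCompactSupport g) (v w : E) :
    Integrable (fun x => lineDeriv ℝ f x v * fderiv ℝ g x w) ν := by
  obtain ⟨C, F, hF, hEq⟩ := hf.exists_lipschitzWith_lineDeriv_eq hgc
  have h1 : (fun x => lineDeriv ℝ f x v * fderiv ℝ g x w)
      = fun x => lineDeriv ℝ F x v * fderiv ℝ g x w := by
    ext x
    by_cases h0 : fderiv ℝ g x w = 0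
    · simp [h0]
    · rw [hEq x (support_fderiv_apply_subset w h0)]
  rw [h1]
  have hint : Integrable (fun x => fderiv ℝ g x w) ν :=
    ((hg.continuous_fderiv one_ne_zero).clm_apply
      continuous_const).integrable_of_hasCompactSupport
      (hgc.mono' (support_fderiv_apply_subset w))
  exact hint.bdd_mul (aestronglyMeasurable_lineDeriv hF.continuous ν)
    (.of_forall fun x => norm_lineDeriv_le_of_lipschitz ℝ hF)

/-- The Jacobian determinant of a locally Lipschitz function and a test function has zero
integral. -/
theorem LocallyLipschitz.integral_jacobian_eq_zero {f g : E → ℝ} (hf : LocallyLipschitz f)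
    (hg : ContDiff ℝ 1 g) (hgc : HasCompactSupport g) (v w : E) :
    ∫ x, (lineDeriv ℝ f x v * fderiv ℝ g x w - lineDeriv ℝ f x w * fderiv ℝ g x v) ∂ν = 0 := by
  obtain ⟨C, F, hF, hEq⟩ := hf.exists_lipschitzWith_lineDeriv_eq hgc
  have h1 (u u' : E) : (fun x => lineDeriv ℝ f x u * fderiv ℝ g x u')
      = fun x => lineDeriv ℝ F x u * fderiv ℝ g x u' := by
    ext x
    by_cases h0 : fderiv ℝ g x u' = 0
    · simp [h0]
    · rw [hEq x (support_fderiv_apply_subset u' h0)]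
  rw [integral_sub (hf.integrable_lineDeriv_mul_fderiv hg hgc v w)
    (hf.integrable_lineDeriv_mul_fderiv hg hgc w v), h1, h1,
    hF.integral_lineDeriv_mul_fderiv_comm hg hgc v w, sub_self]

end LipschitzJacobian

section Plasmon

open Filter Topology Set Complex
open scoped NNReal ComplexConjugate

lemma LocallyLipschitz.contDiffAt_comp {E F G : Type*} [PseudoEMetricSpace E]
    [NormedAddCommGroup F] [NormedSpace ℝ F] [NormedAddCommGroup G] [NormedSpace ℝ G]
    {f : E → F} {g : F → G} (hf : LocallyLipschitz f) (hg : ∀ x, ContDiffAt ℝ 1 g (f x)) :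
    LocallyLipschitz fun x => g (f x) := by
  intro x
  obtain ⟨K, t, ht, hK⟩ := hf x
  obtain ⟨L, s, hs, hL⟩ := (hg x).exists_lipschitzOnWith
  refine ⟨L * K, t ∩ f ⁻¹' s, inter_mem ht (hf.continuous.continuousAt hs), ?_⟩
  exact hL.comp (hK.mono inter_subset_left) fun y hy => hy.2

/-- The complex coordinate `z` on `ℝ × ℝ`. -/
def zCoord : ℝ × ℝ →L[ℝ] ℂ := (equivRealProdCLM.symm : ℝ × ℝ →L[ℝ] ℂ)

/-- The conjugate complex coordinate on `ℝ × ℝ`. -/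
def zbCoord : ℝ × ℝ →L[ℝ] ℂ := (conjCLE : ℂ →L[ℝ] ℂ).comp zCoord

lemma zCoord_apply (p : ℝ × ℝ) : zCoord p = ⟨p.1, p.2⟩ := by
  apply Complex.ext <;> simp [zCoord, equivRealProdCLM_symm_apply]

lemma zbCoord_apply (p : ℝ × ℝ) : zbCoord p = conj (zCoord p) := rfl

lemma nr_eq_norm (p : ℝ × ℝ) : nr p = ‖zCoord p‖ := by
  rw [Complex.norm_def, zCoord_apply, Complex.normSq_mk, nr, sq, sq]

lemma continuous_nr : Continuous nr := by
  unfold nr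
  fun_prop

lemma volume_nr_eq_zero (R : ℝ) : volume {p : ℝ × ℝ | nr p = R} = 0 := by
  have h := volume_preserving_equiv_real_prod.symm.measure_preimage
    (measurableSet_eq_fun continuous_norm.measurable measurable_const
      : MeasurableSet {z : ℂ | ‖z‖ = R}).nullMeasurableSet
  have h2 : {p : ℝ × ℝ | nr p = R} = measurableEquivRealProd.symm ⁻¹' {z : ℂ | ‖z‖ = R} := by
    ext p
    simp only [mem_ofPred_eq, mem_preimage, nr_eq_norm, zCoord_apply,
      measurableEquivRealProd_symm_apply]
  have h3 : {z : ℂ | ‖z‖ = R} = Metric.sphere 0 R := by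
    ext z
    simp
  rw [h2, h, h3, Measure.addHaar_sphere]

/-- `F` has Wirtinger derivatives `a = ∂F` and `b = ∂̄F` at `p`. -/
def HasWirtingerAt (F : ℝ × ℝ → ℂ) (a b : ℂ) (p : ℝ × ℝ) : Prop :=
  HasFDerivAt F (a • zCoord + b • zbCoord) p

lemma HasDerivAt.hasWirtingerAt {G : ℂ → ℂ} {a : ℂ} {p : ℝ × ℝ}
    (h : HasDerivAt G a (zCoord p)) : HasWirtingerAt (fun q => G (zCoord q)) a 0 p := by
  refine ((h.hasFDerivAt.restrictScalars ℝ).comp p zCoord.hasFDerivAt).congr_fderiv ?_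
  ext <;> simp [mul_comm]

lemma HasDerivAt.hasWirtingerAt_conj {G : ℂ → ℂ} {b : ℂ} {p : ℝ × ℝ}
    (h : HasDerivAt G b (zbCoord p)) : HasWirtingerAt (fun q => G (zbCoord q)) 0 b p := by
  refine ((h.hasFDerivAt.restrictScalars ℝ).comp p zbCoord.hasFDerivAt).congr_fderiv ?_
  ext <;> simp [mul_comm]

namespace HasWirtingerAt

variable {F G : ℝ × ℝ → ℂ} {a b a' b' : ℂ} {p : ℝ × ℝ}

lemma add (h : HasWirtingerAt F a b p) (h' : HasWirtingerAt G a' b' p) :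
    HasWirtingerAt (fun q => F q + G q) (a + a') (b + b') p :=
  (HasFDerivAt.add h h').congr_fderiv (by ext <;> simp <;> ring)

lemma mul (h : HasWirtingerAt F a b p) (h' : HasWirtingerAt G a' b' p) :
    HasWirtingerAt (fun q => F q * G q) (F p * a' + G p * a) (F p * b' + G p * b) p :=
  (HasFDerivAt.mul h h').congr_fderiv (by ext <;> simp <;> ring)

lemma const_mul (h : HasWirtingerAt F a b p) (c : ℂ) :
    HasWirtingerAt (fun q => c * F q) (c * a) (c * b) p :=
  (HasFDerivAt.const_mul h c).congr_fderiv (by ext <;> simp <;> ring)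

lemma congr_of_eventuallyEq (h : HasWirtingerAt F a b p) (hG : G =ᶠ[𝓝 p] F) :
    HasWirtingerAt G a b p :=
  HasFDerivAt.congr_of_eventuallyEq h hG

lemma hasFDerivAt_re (h : HasWirtingerAt F a b p) :
    HasFDerivAt (fun q => (F q).re) (reCLM.comp (a • zCoord + b • zbCoord)) p :=
  reCLM.hasFDerivAt.comp p h

lemma hasFDerivAt_im (h : HasWirtingerAt F a b p) :
    HasFDerivAt (fun q => (F q).im) (imCLM.comp (a • zCoord + b • zbCoord)) p :=
  imCLM.hasFDerivAt.comp p h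

lemma fderiv_re_fst (h : HasWirtingerAt F a b p) :
    fderiv ℝ (fun q => (F q).re) p (1, 0) = a.re + b.re := by
  rw [h.hasFDerivAt_re.fderiv]
  simp [zbCoord_apply, zCoord_apply]

lemma fderiv_re_snd (h : HasWirtingerAt F a b p) :
    fderiv ℝ (fun q => (F q).re) p (0, 1) = -a.im + b.im := by
  rw [h.hasFDerivAt_re.fderiv]
  simp [zbCoord_apply, zCoord_apply]

lemma fderiv_im_fst (h : HasWirtingerAt F a b p) :
    fderiv ℝ (fun q => (F q).im) p (1, 0) = a.im + b.im := by
  rw [h.hasFDerivAt_im.fderiv]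
  simp [zbCoord_apply, zCoord_apply]

lemma fderiv_im_snd (h : HasWirtingerAt F a b p) :
    fderiv ℝ (fun q => (F q).im) p (0, 1) = a.re - b.re := by
  rw [h.hasFDerivAt_im.fderiv]
  simp [zbCoord_apply, zCoord_apply, sub_eq_add_neg]

end HasWirtingerAt

/-- The holomorphic part of the exterior plasmon wave. -/
def outerHol (R : ℝ) (k : ℕ) (p : ℝ × ℝ) : ℂ := (R : ℂ) ^ (2 * k) / zCoord p ^ k

/-- The non-holomorphic part of the exterior plasmon wave. -/
def outerCorr (R : ℝ) (k : ℕ) (p : ℝ × ℝ) : ℂ :=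
  zCoord p * (k * (R : ℂ) ^ (2 * k) / zbCoord p ^ (k + 1))
    + -(k * (R : ℂ) ^ (2 * k + 2) / zbCoord p ^ (k + 2))

/-- The stress potential of the plasmon wave, up to the factor `2 * μ * α`, as a function of the
complex coordinate and of `m = max (r ^ 2) (R ^ 2)`. -/
def stressPotAux (R : ℝ) (k : ℕ) (q : ℂ × ℝ) : ℂ :=
  -(conj q.1 ^ k * (R : ℂ) ^ (2 * k) * (((q.2 : ℝ) : ℂ) ^ k)⁻¹)
    + k * ((q.2 : ℂ) - (R : ℂ) ^ 2) * q.1 ^ (k + 2) * (R : ℂ) ^ (2 * k)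
      * (((q.2 : ℝ) : ℂ) ^ (k + 2))⁻¹

/-- The stress potential of the plasmon wave, up to the factor `2 * μ * α`. -/
def stressPot (R : ℝ) (k : ℕ) (p : ℝ × ℝ) : ℂ :=
  stressPotAux R k (zCoord p, max (normSq (zCoord p)) (R ^ 2))

lemma zCoord_mul_zbCoord (p : ℝ × ℝ) : zCoord p * zbCoord p = (normSq (zCoord p) : ℂ) := by
  rw [zbCoord_apply, Complex.mul_conj]

lemma zCoord_ne_zero {R : ℝ} (hR : 0 < R) {p : ℝ × ℝ} (hp : R < nr p) : zCoord p ≠ 0 := by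
  rw [nr_eq_norm] at hp
  exact norm_pos_iff.1 (hR.trans hp)

lemma zbCoord_ne_zero {R : ℝ} (hR : 0 < R) {p : ℝ × ℝ} (hp : R < nr p) : zbCoord p ≠ 0 := by
  rw [zbCoord_apply]
  exact (map_ne_zero _).2 (zCoord_ne_zero hR hp)

lemma stressPot_of_le {R : ℝ} (hR : 0 < R) (k : ℕ) {p : ℝ × ℝ} (hp : nr p ≤ R) :
    stressPot R k p = -(zbCoord p ^ k) := by
  have h : normSq (zCoord p) ≤ R ^ 2 := by
    rw [nr_eq_norm] at hp
    rw [normSq_eq_norm_sq]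
    gcongr
  have hR' : (R : ℂ) ≠ 0 := by exact_mod_cast hR.ne'
  rw [stressPot, max_eq_right h, stressPotAux, zbCoord_apply]
  push_cast
  field_simp
  ring

lemma stressPot_of_lt {R : ℝ} (hR : 0 < R) (k : ℕ) {p : ℝ × ℝ} (hp : R < nr p) :
    stressPot R k p = -1 * outerHol R k p + outerCorr R k p := by
  have h : R ^ 2 ≤ normSq (zCoord p) := by
    rw [nr_eq_norm] at hp
    rw [normSq_eq_norm_sq]
    gcongr
  have h1 := zCoord_ne_zero hR hp
  have h2 := zbCoord_ne_zero hR hp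
  rw [stressPot, max_eq_left h, stressPotAux, outerHol, outerCorr, ← zbCoord_apply]
  simp only [← zCoord_mul_zbCoord, mul_pow]
  field_simp
  ring

lemma locallyLipschitz_comp_stressPot {R : ℝ} (hR : 0 < R) {L : ℂ → ℝ} (hL : ContDiff ℝ 1 L)
    (k : ℕ) : LocallyLipschitz fun p => L (stressPot R k p) := by
  have h1 : LocallyLipschitz fun p : ℝ × ℝ => normSq (zCoord p) := by
    apply ContDiff.locallyLipschitz (𝕂 := ℝ)
    simp only [zCoord_apply, normSq_mk]
    fun_prop
  have h2 : LocallyLipschitz fun p => (zCoord p, max (normSq (zCoord p)) (R ^ 2)) :=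
    (zCoord.lipschitz.locallyLipschitz).prodMk (h1.max_const _)
  refine h2.contDiffAt_comp (g := fun q => L (stressPotAux R k q)) fun p => ?_
  have hm : ((max (normSq (zCoord p)) (R ^ 2) : ℝ) : ℂ) ≠ 0 :=
    ofReal_ne_zero.2 (lt_of_lt_of_le (by positivity) (le_max_right _ _)).ne'
  refine hL.contDiffAt.comp _ ?_
  unfold stressPotAux
  have hc : ContDiff ℝ 1 fun q : ℂ × ℝ => conj q.1 :=
    conjCLE.contDiff.comp contDiff_fst
  have ho : ContDiff ℝ 1 fun q : ℂ × ℝ => ((q.2 : ℝ) : ℂ) :=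
    ofRealCLM.contDiff.comp contDiff_snd
  have hi (n : ℕ) : ContDiffAt ℝ 1 (fun q : ℂ × ℝ => (((q.2 : ℝ) : ℂ) ^ n)⁻¹)
      (zCoord p, max (normSq (zCoord p)) (R ^ 2)) :=
    (ho.pow n).contDiffAt.inv (pow_ne_zero _ hm)
  have hf : ContDiff ℝ 1 fun q : ℂ × ℝ => q.1 := contDiff_fst
  exact ((((hc.pow k).mul contDiff_const).contDiffAt.mul (hi k)).neg).add
    ((((contDiff_const.mul (ho.sub contDiff_const)).mul (hf.pow (k + 2))).mul
      contDiff_const).contDiffAt.mul (hi (k + 2)))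

lemma exists_hasWirtingerAt_outer {R : ℝ} (hR : 0 < R) (k : ℕ) {p : ℝ × ℝ} (hp : R < nr p) :
    ∃ a b : ℂ, HasWirtingerAt (outerHol R k) a 0 p ∧
      HasWirtingerAt (outerCorr R k) (-conj a) b p := by
  have h1 := zCoord_ne_zero hR hp
  have h2 := zbCoord_ne_zero hR hp
  have hH : HasDerivAt (fun z : ℂ => (R : ℂ) ^ (2 * k) / z ^ k)
      (-(k * (R : ℂ) ^ (2 * k) / zCoord p ^ (k + 1))) (zCoord p) := by
    have := ((hasDerivAt_pow k (zCoord p)).inv (pow_ne_zero k h1)).const_mul ((R : ℂ) ^ (2 * k))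
    refine this.congr_deriv ?_
    cases k with
    | zero => simp
    | succ n =>
      simp only [Nat.add_sub_cancel]
      field_simp
      ring
  have hd (c : ℂ) (n : ℕ) : DifferentiableAt ℂ (fun w : ℂ => c / w ^ n) (zbCoord p) := by
    have : zbCoord p ^ n ≠ 0 := pow_ne_zero n h2
    fun_prop (disch := assumption)
  have hc := ((hasDerivAt_id (zCoord p)).hasWirtingerAt.mul
    (hd (k * (R : ℂ) ^ (2 * k)) (k + 1)).hasDerivAt.hasWirtingerAt_conj).add
    (hd (k * (R : ℂ) ^ (2 * k + 2)) (k + 2)).hasDerivAt.neg.hasWirtingerAt_conj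
  have hconj : zCoord p * 0 + k * (R : ℂ) ^ (2 * k) / zbCoord p ^ (k + 1) * 1 + 0
      = -conj (-(k * (R : ℂ) ^ (2 * k) / zCoord p ^ (k + 1))) := by
    simp [zbCoord_apply]
  simp only [id] at hc
  rw [hconj] at hc
  exact ⟨_, _, hH.hasWirtingerAt, hc⟩

/-- In terms of Wirtinger derivatives `∂u = a - α ā`, `∂̄u = α b` the elastic energy density outside
the disk is a Jacobian. -/
lemma energy_eq_jacobian_outer {lam mu α : ℝ} (hα : α * (lam + 3 * mu) = lam + mu) (a b : ℂ)
    (f1x f1y f2x f2y : ℝ) :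
    lam * (((a + α * -conj a).re + (α * b).re) + ((a + α * -conj a).re - (α * b).re))
          * (f1x + f2y)
        + 2 * mu * (((a + α * -conj a).re + (α * b).re) * f1x
          + 2 * (((-(a + α * -conj a).im + (α * b).im) + ((a + α * -conj a).im + (α * b).im)) / 2
              * ((f1y + f2x) / 2))
          + ((a + α * -conj a).re - (α * b).re) * f2y)
      = 2 * mu * α * (((-(-a + -conj a).im + b.im) * f2x - ((-a + -conj a).re + b.re) * f2y)
          + (((-a + -conj a).im + b.im) * f1y - ((-a + -conj a).re - b.re) * f1x)) := by
  simp only [add_re, add_im, mul_re, mul_im, neg_re, neg_im, conj_re, conj_im, ofReal_re,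
    ofReal_im]
  linear_combination (-2 * a.re * (f1x + f2y)) * hα

lemma energy_eq_jacobian_inner (lam mu α : ℝ) (b : ℂ) (f1x f1y f2x f2y : ℝ) :
    -α * (lam * (((0 : ℂ).re + b.re) + ((0 : ℂ).re - b.re)) * (f1x + f2y)
        + 2 * mu * (((0 : ℂ).re + b.re) * f1x
          + 2 * (((-(0 : ℂ).im + b.im) + ((0 : ℂ).im + b.im)) / 2 * ((f1y + f2x) / 2))
          + ((0 : ℂ).re - b.re) * f2y))
      = 2 * mu * α * (((-(-1 * 0 : ℂ).im + (-1 * b).im) * f2x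
            - ((-1 * 0 : ℂ).re + (-1 * b).re) * f2y)
          + (((-1 * 0 : ℂ).im + (-1 * b).im) * f1y - ((-1 * 0 : ℂ).re - (-1 * b).re) * f1x)) := by
  simp only [mul_zero, zero_re, zero_im, neg_mul, one_mul, neg_re, neg_im]
  ring

lemma exists_polar (p : ℝ × ℝ) :
    ∃ θ : ℝ, p = (nr p * Real.cos θ, nr p * Real.sin θ) := by
  refine ⟨arg (zCoord p), ?_⟩
  rw [nr_eq_norm, norm_mul_cos_arg, norm_mul_sin_arg, zCoord_apply]

lemma zCoord_polar (r θ : ℝ) :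
    zCoord (r * Real.cos θ, r * Real.sin θ) = r * exp (θ * I) := by
  rw [zCoord_apply]
  apply Complex.ext <;> simp [exp_ofReal_mul_I_re, exp_ofReal_mul_I_im]

lemma zbCoord_polar (r θ : ℝ) :
    zbCoord (r * Real.cos θ, r * Real.sin θ) = r * (exp (θ * I))⁻¹ := by
  rw [zbCoord_apply, zCoord_polar, map_mul, conj_ofReal, ← exp_conj, ← Complex.exp_neg, map_mul,
    conj_ofReal, conj_I, mul_neg]

lemma exp_natCast_mul_mul_I (n : ℕ) (θ : ℝ) :
    exp (((n * θ : ℝ) : ℂ) * I) = exp (θ * I) ^ n := by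
  rw [← Complex.exp_nat_mul]
  push_cast
  ring_nf

lemma zbCoord_pow_polar (k : ℕ) (r θ : ℝ) :
    zbCoord (r * Real.cos θ, r * Real.sin θ) ^ k
      = ((r ^ k : ℝ) : ℂ) * exp (((-(k * θ) : ℝ) : ℂ) * I) := by
  rw [zbCoord_polar, mul_pow, inv_pow, ← exp_natCast_mul_mul_I, ← Complex.exp_neg]
  push_cast
  ring_nf

lemma outerHol_polar (R : ℝ) (k : ℕ) (r θ : ℝ) :
    outerHol R k (r * Real.cos θ, r * Real.sin θ)
      = ((R ^ (2 * k) / r ^ k : ℝ) : ℂ) * exp (((-(k * θ) : ℝ) : ℂ) * I) := by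
  have : exp (((-(k * θ) : ℝ) : ℂ) * I) = (exp (θ * I) ^ k)⁻¹ := by
    rw [← exp_natCast_mul_mul_I, ← Complex.exp_neg, ofReal_neg, neg_mul]
  rw [outerHol, zCoord_polar, this, mul_pow]
  push_cast
  rw [div_mul_eq_div_div, div_eq_mul_inv]

lemma outerCorr_polar (R : ℝ) (k : ℕ) {r : ℝ} (hr : 0 < r) (θ : ℝ) :
    outerCorr R k (r * Real.cos θ, r * Real.sin θ)
      = ((k * (r ^ 2 - R ^ 2) * R ^ (2 * k) / r ^ (k + 2) : ℝ) : ℂ)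
        * exp ((((k + 2 : ℝ) * θ : ℝ) : ℂ) * I) := by
  have h := exp_natCast_mul_mul_I (k + 2) θ
  push_cast at h
  have hr' : (r : ℂ) ≠ 0 := ofReal_ne_zero.2 hr.ne'
  have he := Complex.exp_ne_zero (θ * I)
  rw [outerCorr, zCoord_polar, zbCoord_polar]
  push_cast
  rw [h]
  generalize exp (θ * I) = e at he
  simp only [mul_pow, inv_pow]
  field_simp
  ring

/-- A function that is almost everywhere a multiple of the Jacobian pairing of a locally Lipschitz
potential with a test field has zero integral. -/
lemma integral_eq_zero_of_ae_eq_jacobian {P : ℝ × ℝ → ℂ}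
    (hre : LocallyLipschitz fun p => (P p).re) (him : LocallyLipschitz fun p => (P p).im)
    {φ : ℝ × ℝ → ℝ × ℝ} (hφ : ContDiff ℝ 1 φ) (hφc : HasCompactSupport φ)
    {F : ℝ × ℝ → ℝ} (C : ℝ) (hF : ∀ᵐ x : ℝ × ℝ, ∃ a b, HasWirtingerAt P a b x ∧
      F x = C * (((-a.im + b.im) * pdx (fun y => (φ y).2) x
          - (a.re + b.re) * pdy (fun y => (φ y).2) x)
        + ((a.im + b.im) * pdy (fun y => (φ y).1) x
          - (a.re - b.re) * pdx (fun y => (φ y).1) x))) :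
    ∫ x, F x = 0 := by
  have h1 : ContDiff ℝ 1 fun y => (φ y).1 := hφ.fst
  have h2 : ContDiff ℝ 1 fun y => (φ y).2 := hφ.snd
  have h1c : HasCompactSupport fun y => (φ y).1 := hφc.comp_left (g := Prod.fst) rfl
  have h2c : HasCompactSupport fun y => (φ y).2 := hφc.comp_left (g := Prod.snd) rfl
  have hF' : F =ᵐ[volume] fun x => C *
      ((lineDeriv ℝ (fun p => (P p).re) x (0, 1) * fderiv ℝ (fun y => (φ y).2) x (1, 0)
          - lineDeriv ℝ (fun p => (P p).re) x (1, 0) * fderiv ℝ (fun y => (φ y).2) x (0, 1))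
        + (lineDeriv ℝ (fun p => (P p).im) x (1, 0) * fderiv ℝ (fun y => (φ y).1) x (0, 1)
          - lineDeriv ℝ (fun p => (P p).im) x (0, 1)
            * fderiv ℝ (fun y => (φ y).1) x (1, 0))) := by
    filter_upwards [hF] with x ⟨a, b, hP, hx⟩
    rw [hx, hP.hasFDerivAt_re.differentiableAt.lineDeriv_eq_fderiv,
      hP.hasFDerivAt_re.differentiableAt.lineDeriv_eq_fderiv,
      hP.hasFDerivAt_im.differentiableAt.lineDeriv_eq_fderiv,
      hP.hasFDerivAt_im.differentiableAt.lineDeriv_eq_fderiv,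
      hP.fderiv_re_fst, hP.fderiv_re_snd, hP.fderiv_im_fst, hP.fderiv_im_snd]
    rfl
  rw [integral_congr_ae hF', integral_const_mul, integral_add,
    hre.integral_jacobian_eq_zero h2 h2c, him.integral_jacobian_eq_zero h1 h1c, add_zero, mul_zero]
  · exact (hre.integrable_lineDeriv_mul_fderiv h2 h2c _ _).sub
      (hre.integrable_lineDeriv_mul_fderiv h2 h2c _ _)
  · exact (him.integrable_lineDeriv_mul_fderiv h1 h1c _ _).sub
      (him.integrable_lineDeriv_mul_fderiv h1 h1c _ _)

lemma partials_of_hasWirtingerAt {ψ : ℝ × ℝ → ℝ × ℝ} {U : ℝ × ℝ → ℂ} {a b : ℂ} {x : ℝ × ℝ}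
    (hU : HasWirtingerAt U a b x) (h : ∀ᶠ y in 𝓝 x, ψ y = ((U y).re, (U y).im)) :
    pdx (fun y => (ψ y).1) x = a.re + b.re ∧ pdy (fun y => (ψ y).1) x = -a.im + b.im ∧
      pdx (fun y => (ψ y).2) x = a.im + b.im ∧ pdy (fun y => (ψ y).2) x = a.re - b.re := by
  have h1 : (fun y => (ψ y).1) =ᶠ[𝓝 x] fun y => (U y).re := h.mono fun y hy => by simp [hy]
  have h2 : (fun y => (ψ y).2) =ᶠ[𝓝 x] fun y => (U y).im := h.mono fun y hy => by simp [hy]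
  simp only [pdx, pdy, h1.fderiv_eq, h2.fderiv_eq]
  exact ⟨hU.fderiv_re_fst, hU.fderiv_re_snd, hU.fderiv_im_fst, hU.fderiv_im_snd⟩

end Plasmon

/-- the perfect plasmon elastic wave ψ̂_k is a weak solution of
∇·(A C_{λ,μ} ∇ˢψ) = 0 on ℝ², where A = c on the disk B_R and A = 1 outside. -/
theorem plasmon_wave_is_weak_solution (lam mu : ℝ) (hmu : 0 < mu)
    (hlm : 0 < lam + mu) (α c : ℝ) (hα : α = (lam + mu) / (lam + 3 * mu))
    (hc : c = -((lam + mu) / (lam + 3 * mu)))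
    (R : ℝ) (hR : 0 < R) (k : ℕ) (hk : 1 ≤ k)
    (ψ : ℝ × ℝ → ℝ × ℝ)
    (hψin : ∀ r θ : ℝ, 0 ≤ r → r ≤ R →
      ψ (r * Real.cos θ, r * Real.sin θ)
        = (r ^ k * Real.cos ((k : ℝ) * θ), -(r ^ k * Real.sin ((k : ℝ) * θ))))
    (hψout : ∀ r θ : ℝ, R < r →
      ψ (r * Real.cos θ, r * Real.sin θ)
        = (R ^ (2 * k) * (Real.cos ((k : ℝ) * θ) / r ^ k
              + (k : ℝ) * α * (r ^ 2 - R ^ 2) * Real.cos (((k : ℝ) + 2) * θ) / r ^ (k + 2)),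
           R ^ (2 * k) * (-(Real.sin ((k : ℝ) * θ) / r ^ k)
              + (k : ℝ) * α * (r ^ 2 - R ^ 2) * Real.sin (((k : ℝ) + 2) * θ) / r ^ (k + 2))))
    (A : ℝ × ℝ → ℝ)
    (hA : ∀ x : ℝ × ℝ, (nr x ≤ R → A x = c) ∧ (R < nr x → A x = 1)) :
    ∀ φ : ℝ × ℝ → ℝ × ℝ, ContDiff ℝ 1 φ → HasCompactSupport φ →
      ∫ x : ℝ × ℝ,
        A x * (lam * div2 ψ x * div2 φ x + 2 * mu * sgFrob ψ φ x) = 0 := by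
  intro φ hφ hφc
  have hα' : α * (lam + 3 * mu) = lam + mu := by
    rw [hα, div_mul_cancel₀ _ (by linarith : 0 < lam + 3 * mu).ne']
  have hcα : c = -α := by rw [hc, hα]
  have hin : ∀ p, nr p ≤ R → ψ p = ((zbCoord p ^ k).re, (zbCoord p ^ k).im) := by
    intro p hp
    obtain ⟨θ, hθ⟩ := exists_polar p
    rw [hθ, hψin (nr p) θ (Real.sqrt_nonneg _) hp, zbCoord_pow_polar, Complex.re_ofReal_mul,
      Complex.im_ofReal_mul, Complex.exp_ofReal_mul_I_re, Complex.exp_ofReal_mul_I_im,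
      Real.cos_neg, Real.sin_neg, mul_neg]
  have hout : ∀ p, R < nr p → ψ p = ((outerHol R k p + α * outerCorr R k p).re,
      (outerHol R k p + α * outerCorr R k p).im) := by
    intro p hp
    obtain ⟨θ, hθ⟩ := exists_polar p
    rw [hθ, hψout _ θ hp, outerHol_polar, outerCorr_polar R k (hR.trans hp)]
    simp only [Complex.add_re, Complex.add_im, Complex.re_ofReal_mul,
      Complex.im_ofReal_mul, Complex.exp_ofReal_mul_I_re, Complex.exp_ofReal_mul_I_im,
      Real.cos_neg, Real.sin_neg]
    ext <;> ring
  refine integral_eq_zero_of_ae_eq_jacobian (P := stressPot R k)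
    (locallyLipschitz_comp_stressPot hR Complex.reCLM.contDiff k)
    (locallyLipschitz_comp_stressPot hR Complex.imCLM.contDiff k) hφ hφc (2 * mu * α) ?_
  have hae : ∀ᵐ x : ℝ × ℝ, nr x ≠ R := by
    rw [ae_iff]
    simpa using volume_nr_eq_zero R
  filter_upwards [hae] with x hx
  rcases lt_or_gt_of_ne hx with hlt | hgt
  · have hev : ∀ᶠ y in nhds x, nr y < R := continuous_nr.continuousAt.eventually_lt_const hlt
    have hU := ((hasDerivAt_pow k (zbCoord x)).hasWirtingerAt_conj)
    have hP := (hU.const_mul (-1)).congr_of_eventuallyEq (G := stressPot R k)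
      (hev.mono fun y hy => by simp [stressPot_of_le hR k hy.le])
    refine ⟨_, _, hP, ?_⟩
    obtain ⟨e1, e2, e3, e4⟩ := partials_of_hasWirtingerAt hU (hev.mono fun y hy => hin y hy.le)
    rw [(hA x).1 hlt.le, hcα, ← energy_eq_jacobian_inner lam]
    simp only [div2, sgFrob, sg11, sg12, sg22, e1, e2, e3, e4]
  · have hev : ∀ᶠ y in nhds x, R < nr y := continuous_nr.continuousAt.eventually_const_lt hgt
    obtain ⟨a, b, hH, hV⟩ := exists_hasWirtingerAt_outer hR k hgt
    have hU := hH.add (hV.const_mul α)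
    have hP := ((hH.const_mul (-1)).add hV).congr_of_eventuallyEq
      (hev.mono fun y hy => stressPot_of_lt hR k hy)
    rw [zero_add] at hU
    rw [mul_zero, zero_add, neg_one_mul] at hP
    refine ⟨_, _, hP, ?_⟩
    obtain ⟨e1, e2, e3, e4⟩ := partials_of_hasWirtingerAt hU (hev.mono fun y hy => hout y hy)
    rw [(hA x).2 hgt, one_mul, ← energy_eq_jacobian_outer hα']
    simp only [div2, sgFrob, sg11, sg12, sg22, e1, e2, e3, e4]
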